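/- If G is a rainbow K_r-saturated graph (r ≥ 4) and x, y are two nonadjacent vertices of G both of degree exactly r−2, then x and y have the same neighborhood and this common neighborhood induces a complete graph K_{r−2} in G. -/

import Mathlib

open SimpleGraph

/-- A proper edge coloring: edges sharing a vertex get distinct colors. -/
def IsProperEdgeColoring {V : Type*} {α : Type*} (G : SimpleGraph V) (c : Sym2 V → α) : Prop :=
  ∀ e ∈ G.edgeSet, ∀ f ∈ G.edgeSet, e ≠ f → (∃ x, x ∈ e ∧ x ∈ f) → c e ≠ c f

/-- A rainbow copy of `H` in `G` under the coloring `c`: an injective homomorphism whose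
edge images receive pairwise distinct colors. -/
def HasRainbowCopy {W V : Type*} {α : Type*} (H : SimpleGraph W) (G : SimpleGraph V)
    (c : Sym2 V → α) : Prop :=
  ∃ f : H →g G, Function.Injective f ∧
    ∀ e ∈ H.edgeSet, ∀ e' ∈ H.edgeSet, e ≠ e' → c (Sym2.map f e) ≠ c (Sym2.map f e')

/-- The graph `G` with the extra edge `xy`. -/
def addEdge {V : Type*} (G : SimpleGraph V) (x y : V) : SimpleGraph V :=
  G ⊔ SimpleGraph.fromEdgeSet {s(x, y)}

/-- `G` is rainbow `H`-saturated. -/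
def RainbowSaturated {V W : Type*} (G : SimpleGraph V) (H : SimpleGraph W) : Prop :=
  (∃ c : Sym2 V → ℕ, IsProperEdgeColoring G c ∧ ¬ HasRainbowCopy H G c) ∧
  ∀ x y : V, x ≠ y → ¬ G.Adj x y →
    ∀ c : Sym2 V → ℕ, IsProperEdgeColoring (addEdge G x y) c →
      HasRainbowCopy H (addEdge G x y) c

/-- The rainbow saturation number: the least number of edges of an `n`-vertex
rainbow `H`-saturated graph. -/
noncomputable def rainbowSatNum {W : Type*} (n : ℕ) (H : SimpleGraph W) : ℕ :=
  sInf {m | ∃ G : SimpleGraph (Fin n), RainbowSaturated G H ∧ G.edgeSet.ncard = m}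

theorem stmt16 {V : Type*} (r : ℕ) (hr : 4 ≤ r) (G : SimpleGraph V)
    (hG : RainbowSaturated G (⊤ : SimpleGraph (Fin r)))
    (x y : V) (hxy : x ≠ y) (hadj : ¬ G.Adj x y)
    (hx : (G.neighborSet x).ncard = r - 2) (hy : (G.neighborSet y).ncard = r - 2) :
    G.neighborSet x = G.neighborSet y ∧
    ∀ u ∈ G.neighborSet x, ∀ v ∈ G.neighborSet x, u ≠ v → G.Adj u v := by
  classical
  have hA : ∀ a b, (addEdge G x y).Adj a b ↔ G.Adj a b ∨ (s(a, b) = s(x, y) ∧ a ≠ b) := by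
    intro a b
    simp only [addEdge, SimpleGraph.sup_adj, SimpleGraph.fromEdgeSet_adj, Set.mem_singleton_iff]
  obtain ⟨⟨c, hc, hno⟩, hsat⟩ := hG
  have hE : ∀ e ∈ (addEdge G x y).edgeSet, e ≠ s(x, y) → e ∈ G.edgeSet := by
    intro e he hne
    induction e with
    | _ a b =>
      rw [SimpleGraph.mem_edgeSet, hA] at he
      rcases he with h | h
      · exact h
      · exact absurd h.1 hne
  obtain ⟨f, hinj, hrb⟩ := hsat x y hxy hadj (fun e => if e = s(x, y) then 0 else c e + 1) (by
    intro e he e' he' hne hv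
    by_cases h1 : e = s(x, y)
    · have h2 : e' ≠ s(x, y) := fun h => hne (h1.trans h.symm)
      simp [h1, h2]
    · by_cases h2 : e' = s(x, y)
      · simp [h1, h2]
      · have := hc e (hE e he h1) e' (hE e' he' h2) hne hv
        simpa [h1, h2] using this)
  have hfA : ∀ a b, a ≠ b → (addEdge G x y).Adj (f a) (f b) := fun a b h => f.map_adj h
  have key : ∃ i j, f i = x ∧ f j = y := by
    by_contra hcon
    have hn : ∀ a b, s(f a, f b) ≠ s(x, y) := by
      intro a b h
      rw [Sym2.eq_iff] at h
      rcases h with ⟨h1, h2⟩ | ⟨h1, h2⟩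
      · exact hcon ⟨a, b, h1, h2⟩
      · exact hcon ⟨b, a, h2, h1⟩
    have hn' : ∀ e : Sym2 (Fin r), Sym2.map f e ≠ s(x, y) := by
      intro e
      induction e with
      | _ a b => exact hn a b
    apply hno
    refine ⟨⟨f, ?_⟩, hinj, ?_⟩
    · intro a b hab
      rcases (hA _ _).1 (f.map_adj hab) with h | h
      · exact h
      · exact absurd h.1 (hn a b)
    · intro e he e' he' hne
      have := hrb e he e' he' hne
      simpa [hn' e, hn' e'] using this
  obtain ⟨i, j, hi, hj⟩ := key
  have hij : i ≠ j := by
    rintro rfl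
    exact hxy (hi.symm.trans hj)
  have hG' : ∀ a b, a ≠ b → a ≠ i → a ≠ j → G.Adj (f a) (f b) := by
    intro a b hab h1 h2
    rcases (hA _ _).1 (hfA a b hab) with h | h
    · exact h
    · have h3 := h.1
      rw [Sym2.eq_iff] at h3
      rcases h3 with h3 | h3
      · exact absurd (hinj (h3.1.trans hi.symm)) h1
      · exact absurd (hinj (h3.1.trans hj.symm)) h2
  let T : Finset (Fin r) := (Finset.univ.erase i).erase j
  have hT : ∀ a, a ∈ T ↔ a ≠ j ∧ a ≠ i := by simp [T]
  have hcard : T.card = r - 2 := by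
    simp only [T]
    rw [Finset.card_erase_of_mem (by simp [hij.symm]), Finset.card_erase_of_mem (by simp)]
    simp
    omega
  have hS : (f '' (T : Set (Fin r))).ncard = r - 2 := by
    rw [Set.ncard_image_of_injective _ hinj, Set.ncard_coe_finset, hcard]
  have main : ∀ k, (k = i ∨ k = j) → (G.neighborSet (f k)).ncard = r - 2 →
      f '' (T : Set (Fin r)) = G.neighborSet (f k) := by
    intro k hk hn
    apply Set.eq_of_subset_of_ncard_le
    · rintro _ ⟨a, ha, rfl⟩
      have ha' := (hT a).1 ha
      have hak : a ≠ k := by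
        rcases hk with rfl | rfl
        · exact ha'.2
        · exact ha'.1
      exact (hG' a k hak ha'.2 ha'.1).symm
    · rw [hn, hS]
    · exact Set.finite_of_ncard_pos (by omega)
  have e1 := main i (Or.inl rfl) (by rw [hi]; exact hx)
  have e2 := main j (Or.inr rfl) (by rw [hj]; exact hy)
  rw [hi] at e1
  rw [hj] at e2
  refine ⟨e1.symm.trans e2, ?_⟩
  rw [← e1]
  rintro _ ⟨a, ha, rfl⟩ _ ⟨b, hb, rfl⟩ hne
  have ha' := (hT a).1 ha
  exact hG' a b (fun h => hne (by rw [h])) ha'.2 ha'.1
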